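/- Fix any c₁ ∈ (0, 2) and set c₂ := ( ∫_{c₁}^{2} x/(e^{2x} − 1) dx )^{1/4}. Then for all R, ε, Δ > 0, all N ≥ 1, and every decreasing sequence τ₁ > τ₂ > ⋯ > τ_N > 0 with τ₁ ≥ 2, the quantity E := 2R · ( e^{−2τ₁} R² / (4(1 − e^{−2τ₁})) + Σ_{j=2}^{N} e^{−2τ_j} τ_{j−1}² ε² / (4(1 − e^{−2τ_j}) Δ²) )^{1/4} + τ_N · ε/Δ satisfies E ≥ min{ c₁ · ε/Δ, c₂ · R · sqrt(ε/Δ) }. -/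

import Mathlib

open scoped ENNReal NNReal

noncomputable section

theorem antitoneOn_div_exp_two_mul_sub_one :
    AntitoneOn (fun x : ℝ => x / (Real.exp (2 * x) - 1)) (Set.Ioi 0) := by
  intro x hx y hy hxy
  rw [Set.mem_Ioi] at hx hy
  have hex : 0 < Real.exp (2 * x) - 1 := sub_pos.2 (Real.one_lt_exp_iff.2 (by linarith))
  have hey : 0 < Real.exp (2 * y) - 1 := sub_pos.2 (Real.one_lt_exp_iff.2 (by linarith))
  have hconv := convexOn_exp.2 (Set.mem_univ 0) (Set.mem_univ (2 * y))
    (sub_nonneg.2 (div_le_one_of_le₀ hxy hy.le)) (div_nonneg hx.le hy.le) (by ring)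
  have harg : (1 - x / y) • (0 : ℝ) + (x / y) • (2 * y) = 2 * x := by
    simp only [smul_eq_mul]
    field_simp
    ring
  rw [harg, Real.exp_zero] at hconv
  simp only [smul_eq_mul] at hconv
  have hsecant : y * (Real.exp (2 * x) - 1) ≤ x * (Real.exp (2 * y) - 1) := by
    calc y * (Real.exp (2 * x) - 1)
        ≤ y * (x / y * (Real.exp (2 * y) - 1)) :=
          mul_le_mul_of_nonneg_left (by linarith) hy.le
      _ = x * (Real.exp (2 * y) - 1) := by field_simp
  exact (div_le_div_iff₀ hey hex).2 hsecant

theorem intervalIntegrable_div_exp_two_mul_sub_one {a b : ℝ} (ha : 0 < a) (hb : 0 < b) :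
    IntervalIntegrable (fun x : ℝ => x / (Real.exp (2 * x) - 1)) MeasureTheory.volume a b :=
  (antitoneOn_div_exp_two_mul_sub_one.mono
    fun _ hx => (lt_min ha hb).trans_le hx.1).intervalIntegrable

theorem div_exp_two_mul_sub_one_nonneg {x : ℝ} (hx : 0 ≤ x) :
    0 ≤ x / (Real.exp (2 * x) - 1) :=
  div_nonneg hx (sub_nonneg.2 (Real.one_le_exp (by linarith)))

/-- One summand of the bound dominates the integral over the corresponding step. -/
theorem integral_step_le {s t ε Δ : ℝ} (ht : 0 < t) (hts : t ≤ s) :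
    (∫ x in t..s, x / (Real.exp (2 * x) - 1)) * ((ε / Δ) ^ 2 / 4) ≤
      Real.exp (-2 * t) * s ^ 2 * ε ^ 2 / (4 * (1 - Real.exp (-2 * t)) * Δ ^ 2) := by
  have he : 0 < Real.exp (2 * t) - 1 := sub_pos.2 (Real.one_lt_exp_iff.2 (by linarith))
  have hterm : Real.exp (-2 * t) * s ^ 2 * ε ^ 2 / (4 * (1 - Real.exp (-2 * t)) * Δ ^ 2) =
      s ^ 2 / (Real.exp (2 * t) - 1) * ((ε / Δ) ^ 2 / 4) := by
    have hratio : Real.exp (-2 * t) / (1 - Real.exp (-2 * t)) = 1 / (Real.exp (2 * t) - 1) := by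
      rw [neg_mul, Real.exp_neg]
      have := Real.exp_pos (2 * t)
      rw [← mul_div_mul_left _ _ this.ne', mul_sub, mul_inv_cancel₀ this.ne', mul_one]
    calc Real.exp (-2 * t) * s ^ 2 * ε ^ 2 / (4 * (1 - Real.exp (-2 * t)) * Δ ^ 2)
        = Real.exp (-2 * t) / (1 - Real.exp (-2 * t)) * (s ^ 2 * ε ^ 2 / (4 * Δ ^ 2)) := by
          rw [div_mul_div_comm]; congr 1 <;> ring
      _ = s ^ 2 / (Real.exp (2 * t) - 1) * ((ε / Δ) ^ 2 / 4) := by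
          rw [hratio]; ring
  rw [hterm]
  refine mul_le_mul_of_nonneg_right ?_ (by positivity)
  calc ∫ x in t..s, x / (Real.exp (2 * x) - 1)
      ≤ ∫ _ in t..s, t / (Real.exp (2 * t) - 1) :=
        intervalIntegral.integral_mono_on hts
          (intervalIntegrable_div_exp_two_mul_sub_one ht (ht.trans_le hts))
          intervalIntegrable_const
          fun x hx => antitoneOn_div_exp_two_mul_sub_one ht (ht.trans_le hx.1) hx.1
    _ = (s - t) * t / (Real.exp (2 * t) - 1) := by
        rw [intervalIntegral.integral_const, smul_eq_mul, mul_div_assoc]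
    _ ≤ s ^ 2 / (Real.exp (2 * t) - 1) := by
        gcongr
        nlinarith

theorem integral_le_sum_steps {ε Δ : ℝ} {τ : ℕ → ℝ} {n : ℕ} (hn : 1 ≤ n)
    (hτ : ∀ i, 1 ≤ i → i < n → τ (i + 1) < τ i) (hpos : 0 < τ n) :
    τ n ≤ τ 1 ∧ (∫ x in τ n..τ 1, x / (Real.exp (2 * x) - 1)) * ((ε / Δ) ^ 2 / 4) ≤
      ∑ j ∈ Finset.Icc 2 n, Real.exp (-2 * τ j) * (τ (j - 1)) ^ 2 * ε ^ 2 /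
        (4 * (1 - Real.exp (-2 * τ j)) * Δ ^ 2) := by
  induction n, hn using Nat.le_induction with
  | base => simp
  | succ n hn ih =>
    have hlt := hτ n hn n.lt_succ_self
    have hpos' := hpos.trans hlt
    obtain ⟨hle, hsum⟩ := ih (fun i hi hin => hτ i hi (hin.trans n.lt_succ_self)) hpos'
    refine ⟨hlt.le.trans hle, ?_⟩
    rw [Finset.sum_Icc_succ_top (by omega), Nat.add_sub_cancel,
      ← intervalIntegral.integral_add_adjacent_intervals
        (intervalIntegrable_div_exp_two_mul_sub_one hpos hpos')
        (intervalIntegrable_div_exp_two_mul_sub_one hpos' (hpos'.trans_le hle)),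
      add_mul, add_comm]
    exact add_le_add hsum (integral_step_le hpos hlt.le)

theorem rpow_quarter_mul_sqrt_le {I q : ℝ} (hI : 0 ≤ I) (hq : 0 ≤ q) :
    I ^ ((1 : ℝ) / 4) * Real.sqrt q ≤ 2 * (I * (q ^ 2 / 4)) ^ ((1 : ℝ) / 4) := by
  have hsqrt : Real.sqrt q = (q ^ 2) ^ ((1 : ℝ) / 4) := by
    rw [Real.sqrt_eq_rpow, ← Real.rpow_natCast, ← Real.rpow_mul hq]
    norm_num
  have htwo : (2 : ℝ) = 16 ^ ((1 : ℝ) / 4) := by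
    rw [show (16 : ℝ) = 2 ^ (4 : ℝ) by norm_num, ← Real.rpow_mul (by norm_num)]
    norm_num
  rw [hsqrt, ← Real.mul_rpow hI (by positivity)]
  conv_rhs => enter [1]; rw [htwo]
  rw [← Real.mul_rpow (by norm_num) (by positivity)]
  refine Real.rpow_le_rpow (by positivity) ?_ (by norm_num)
  nlinarith [mul_nonneg hI (sq_nonneg q)]

/-- Lower bound on the Ornstein–Uhlenbeck instantiation of the Theorem 3.1 upper
bound: for any sampling time schedule with `τ₁ ≥ 2`, the bound `E` is at least
`min(c₁ ε/Δ, c₂ R √(ε/Δ))` where `c₂ = (∫_{c₁}^2 x/(e^{2x}-1) dx)^{1/4}`. -/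
theorem ou_bound_lower_bound (c₁ : ℝ) (hc₁ : c₁ ∈ Set.Ioo (0 : ℝ) 2) :
    ∀ R ε Δ : ℝ, 0 < R → 0 < ε → 0 < Δ →
    ∀ N : ℕ, 1 ≤ N →
    ∀ τ : ℕ → ℝ,
      (∀ i, 1 ≤ i → i < N → τ (i + 1) < τ i) → 0 < τ N → 2 ≤ τ 1 →
      min (c₁ * (ε / Δ))
          ((∫ x in c₁..2, x / (Real.exp (2 * x) - 1)) ^ ((1 : ℝ) / 4) * R *
            Real.sqrt (ε / Δ)) ≤
        2 * R *
            (Real.exp (-2 * τ 1) * R ^ 2 / (4 * (1 - Real.exp (-2 * τ 1))) +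
              ∑ j ∈ Finset.Icc 2 N,
                Real.exp (-2 * τ j) * (τ (j - 1)) ^ 2 * ε ^ 2 /
                  (4 * (1 - Real.exp (-2 * τ j)) * Δ ^ 2)) ^ ((1 : ℝ) / 4) +
          τ N * (ε / Δ) := by
  intro R ε Δ hR hε hΔ N hN τ hτ hpos hτ₁
  obtain ⟨hc₀, hc₂⟩ := hc₁
  have hq : 0 < ε / Δ := div_pos hε hΔ
  obtain ⟨hle, hsum⟩ := integral_le_sum_steps (ε := ε) (Δ := Δ) hN hτ hpos
  have hfirst : 0 ≤ Real.exp (-2 * τ 1) * R ^ 2 / (4 * (1 - Real.exp (-2 * τ 1))) := by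
    have : Real.exp (-2 * τ 1) ≤ 1 := Real.exp_le_one_iff.2 (by linarith)
    exact div_nonneg (by positivity) (by linarith)
  have hfull : 0 ≤ ∫ x in τ N..τ 1, x / (Real.exp (2 * x) - 1) :=
    intervalIntegral.integral_nonneg hle
      fun x hx => div_exp_two_mul_sub_one_nonneg (hpos.le.trans hx.1)
  have hsum₀ := (mul_nonneg hfull (by positivity : 0 ≤ (ε / Δ) ^ 2 / 4)).trans hsum
  rcases le_or_gt c₁ (τ N) with hc | hc
  · refine (min_le_left _ _).trans ((mul_le_mul_of_nonneg_right hc hq.le).trans ?_)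
    exact le_add_of_nonneg_left
      (mul_nonneg (by positivity) (Real.rpow_nonneg (add_nonneg hfirst hsum₀) _))
  · refine (min_le_right _ _).trans (le_add_of_le_of_nonneg ?_ (by positivity))
    have hI : 0 ≤ ∫ x in c₁..2, x / (Real.exp (2 * x) - 1) :=
      intervalIntegral.integral_nonneg hc₂.le
        fun x hx => div_exp_two_mul_sub_one_nonneg (hc₀.le.trans hx.1)
    have hmono : ∫ x in c₁..2, x / (Real.exp (2 * x) - 1) ≤
        ∫ x in τ N..τ 1, x / (Real.exp (2 * x) - 1) := by
      refine intervalIntegral.integral_mono_interval hc.le hc₂.le hτ₁ ?_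
        (intervalIntegrable_div_exp_two_mul_sub_one hpos (hpos.trans_le hle))
      filter_upwards [MeasureTheory.ae_restrict_mem measurableSet_Ioc] with x hx
      exact div_exp_two_mul_sub_one_nonneg (hpos.trans hx.1).le
    calc _ = R * ((∫ x in c₁..2, x / (Real.exp (2 * x) - 1)) ^ ((1 : ℝ) / 4) *
            Real.sqrt (ε / Δ)) := by ring
      _ ≤ R * (2 * ((∫ x in c₁..2, x / (Real.exp (2 * x) - 1)) *
            ((ε / Δ) ^ 2 / 4)) ^ ((1 : ℝ) / 4)) :=
          mul_le_mul_of_nonneg_left (rpow_quarter_mul_sqrt_le hI hq.le) hR.le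
      _ = 2 * R * ((∫ x in c₁..2, x / (Real.exp (2 * x) - 1)) *
            ((ε / Δ) ^ 2 / 4)) ^ ((1 : ℝ) / 4) := by ring
      _ ≤ _ := by
          refine mul_le_mul_of_nonneg_left (Real.rpow_le_rpow (by positivity) ?_ (by norm_num))
            (by positivity)
          exact ((mul_le_mul_of_nonneg_right hmono (by positivity)).trans hsum).trans
            (le_add_of_nonneg_left hfirst)
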